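/- arXiv:0910.3038 — 2 statements merged into one kernel-verified Lean document; each statement's English description precedes it below -/
import Mathlib

section
/- If w = A^{m₁}B^{n₁}⋯A^{m_j}B^{n_j} is a cyclically reduced word in the free group F(A,B) with j ≥ 1 and all exponents nonzero, and some cyclic conjugate of w is a member of a basis of F(A,B), then after possibly replacing A by A⁻¹ and/or B by B⁻¹, there exists e > 0 such that either all m_i = 1 and {n₁,…,n_j} ⊆ {e, e+1}, or all n_i = 1 and {m₁,…,m_j} ⊆ {e, e+1}. -/
abbrev F2 := FreeGroup Bool

def A : F2 := FreeGroup.of true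

def B : F2 := FreeGroup.of false

/-- `(x, y)` is a basis (free generating pair) of the free group `F2 = F(A,B)`. -/
def IsBasis (x y : F2) : Prop := ∃ e : F2 ≃* F2, e A = x ∧ e B = y

/-- `w` is primitive: it is part of some basis of `F2`. -/
def IsPrimitive (w : F2) : Prop := ∃ x y : F2, IsBasis x y ∧ (w = x ∨ w = y)

section WhiteheadGraph

open List
open FreeGroup hiding norm IsReduced map_mul

/-- `w` is the image of a generator under an automorphism. -/
def IsBasisElement (w : F2) : Prop := ∃ (b : Bool) (e : F2 ≃* F2), e (FreeGroup.of b) = w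

/-- `y` follows `x` in the cyclic word `l`. -/
def CyclicAdj {α : Type*} (l : List α) (x y : α) : Prop :=
  ∃ t, l ~r t ++ [x] ∧ (t ++ [x]).head? = some y

section CyclicWords

variable {α : Type*}

theorem exists_append_of_isRotated {l l' : List α} (h : l ~r l') :
    ∃ p q, l = p ++ q ∧ l' = q ++ p := by
  obtain ⟨n, hn, rfl⟩ := isRotated_iff_mod.1 h
  exact ⟨l.take n, l.drop n, (take_append_drop n l).symm, rotate_eq_drop_append_take hn⟩

theorem CyclicAdj.of_split {l p q : List α} {x y : α} (h : l = p ++ x :: y :: q) :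
    CyclicAdj l x y := by
  refine ⟨y :: q ++ p, ?_, by simp⟩
  have : l = (p ++ [x]) ++ (y :: q) := by simp [h]
  rw [this]
  convert isRotated_append (l := p ++ [x]) (l' := y :: q) using 1
  simp

theorem CyclicAdj.mem {l : List α} {x y : α} (h : CyclicAdj l x y) : x ∈ l ∧ y ∈ l := by
  obtain ⟨t, ht, hh⟩ := h
  exact ⟨ht.mem_iff.2 (by simp), ht.mem_iff.2 (mem_of_mem_head? hh)⟩

theorem CyclicAdj.of_isRotated {l l' : List α} {x y : α} (hl : l ~r l') (h : CyclicAdj l' x y) :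
    CyclicAdj l x y := by
  obtain ⟨t, ht, hh⟩ := h
  exact ⟨t, hl.trans ht, hh⟩

theorem exists_split_of_change (P : α → Prop) {b : α} :
    ∀ (t : List α) (a : α), P a → b ∈ t → ¬ P b →
      ∃ p x y q, a :: t = p ++ x :: y :: q ∧ P x ∧ ¬ P y
  | [], _, _, hb, _ => by simp at hb
  | c :: t, a, ha, hb, hnb => by
    by_cases hc : P c
    · have hbt : b ∈ t := by
        rcases mem_cons.1 hb with rfl | h
        · exact absurd hc hnb
        · exact h
      obtain ⟨p, x, y, q, h, hx, hy⟩ := exists_split_of_change P t c hc hbt hnb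
      exact ⟨a :: p, x, y, q, by simp [h], hx, hy⟩
    · exact ⟨[], a, c, t, rfl, ha, hc⟩

theorem isRotated_cons_of_mem {l : List α} {a : α} (h : a ∈ l) : ∃ t, l ~r a :: t := by
  obtain ⟨p, q, rfl⟩ := append_of_mem h
  exact ⟨q ++ p, by simpa using isRotated_append (l := p) (l' := a :: q)⟩

theorem exists_cyclicAdj_of_change (P : α → Prop) {l : List α} {a b : α} (ha : a ∈ l) (hb : b ∈ l)
    (hPa : P a) (hPb : ¬ P b) : ∃ x y, CyclicAdj l x y ∧ P x ∧ ¬ P y := by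
  obtain ⟨t, ht⟩ := isRotated_cons_of_mem ha
  have hbt : b ∈ t := by
    rcases mem_cons.1 (ht.mem_iff.1 hb) with rfl | h
    · exact absurd hPa hPb
    · exact h
  obtain ⟨p, x, y, q, h, hx, hy⟩ := exists_split_of_change P t a hPa hbt hPb
  exact ⟨x, y, CyclicAdj.of_isRotated ht (CyclicAdj.of_split h), hx, hy⟩

theorem isCyclicallyReduced_of_isRotated {W W' : List (α × Bool)} (h : IsCyclicallyReduced W)
    (hr : W ~r W') : IsCyclicallyReduced W' := by
  obtain ⟨p, q, rfl, rfl⟩ := exists_append_of_isRotated hr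
  have h3 := (h.flatten_replicate 3).isReduced
  have h2 : FreeGroup.IsReduced ((q ++ p) ++ (q ++ p)) :=
    h3.infix ⟨p, q, by simp [replicate_succ]⟩
  exact ⟨h2.infix ⟨[], q ++ p, by simp⟩, (isChain_append.1 h2).2.2⟩

theorem isCyclicallyReduced_invRev {W : List (α × Bool)} (h : IsCyclicallyReduced W) :
    IsCyclicallyReduced (invRev W) := by
  refine ⟨?_, ?_⟩
  · have h1 := h.1
    unfold FreeGroup.IsReduced at *
    rw [invRev, isChain_reverse, isChain_map]
    refine h1.imp ?_
    intro a b hab h'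
    simp only at h' ⊢
    rw [hab h'.symm]
  · intro a ha b hb hab
    simp only [invRev, getLast?_reverse, head?_reverse, head?_map, getLast?_map, Option.mem_def,
      Option.map_eq_some_iff] at ha hb
    obtain ⟨a, ha, rfl⟩ := ha
    obtain ⟨b, hb, rfl⟩ := hb
    simp only at hab ⊢
    rw [h.2 b hb a ha hab.symm]

end CyclicWords

section Coloring

theorem finite_norm_lt (N : ℕ) : {g : F2 | g.norm < N}.Finite :=
  (List.finite_length_lt (Bool × Bool) N).preimage toWord_injective.injOn

theorem apply_mul_mk_of_norm_le {c : F2 → Bool} {N : ℕ}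
    (hN : ∀ g s, N ≤ FreeGroup.norm g → c (g * mk [s]) = c g) :
    ∀ (P : List (Bool × Bool)) (g : F2), N + P.length ≤ FreeGroup.norm g → c (g * mk P) = c g
  | [], g, _ => by rw [← one_eq_mk, mul_one]
  | s :: P, g, hg => by
    have h1 : FreeGroup.norm g ≤ FreeGroup.norm (g * mk [s]) + 1 := by
      calc FreeGroup.norm g = FreeGroup.norm (g * mk [s] * (mk [s])⁻¹) := by
            rw [mul_inv_cancel_right]
        _ ≤ FreeGroup.norm (g * mk [s]) + FreeGroup.norm (mk [s])⁻¹ := norm_mul_le _ _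
        _ ≤ FreeGroup.norm (g * mk [s]) + 1 := by
          rw [norm_inv_eq]
          exact Nat.add_le_add_left norm_mk_le _
    simp only [length_cons] at hg
    have h2 : g * mk (s :: P) = g * mk [s] * mk P := by
      rw [mul_assoc, mul_mk]; rfl
    rw [h2, apply_mul_mk_of_norm_le hN P _ (by omega), hN g s (by omega)]

theorem apply_mul_of_norm_le {c : F2 → Bool} {N : ℕ}
    (hN : ∀ g s, N ≤ FreeGroup.norm g → c (g * mk [s]) = c g) (p g : F2)
    (hg : N + FreeGroup.norm p ≤ FreeGroup.norm g) :
    c (g * p) = c g := by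
  rw [← mk_toWord (x := p)]
  exact apply_mul_mk_of_norm_le hN _ g hg

theorem apply_mul_pow {c : F2 → Bool} {w : F2} (hw : ∀ g, c (g * w) = c g) (n : ℕ) (g : F2) :
    c (g * w ^ n) = c g := by
  induction n generalizing g with
  | zero => simp
  | succ n ih => rw [pow_succ, ← mul_assoc, hw, ih]

/-- All reduced words of length at least `N` extending `L` have color `k`. -/
def IsMono (c : F2 → Bool) (N : ℕ) (L : List (Bool × Bool)) (k : Bool) : Prop :=
  ∀ L', FreeGroup.IsReduced (L ++ L') → N ≤ (L ++ L').length → c (mk (L ++ L')) = k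

theorem FreeGroup.IsReduced.norm_mk {L : List (Bool × Bool)} (h : FreeGroup.IsReduced L) :
    FreeGroup.norm (mk L) = L.length := by
  rw [FreeGroup.norm, toWord_mk, h.reduce_eq]

theorem color_eq_of_ray {c : F2 → Bool} {N : ℕ}
    (hN : ∀ g s, N ≤ FreeGroup.norm g → c (g * mk [s]) = c g) {w p : F2} (hw : ∀ g, c (g * w) = c g)
    {W : List (Bool × Bool)} (hW : IsCyclicallyReduced W) (hp : mk W = p⁻¹ * w * p)
    {t : Bool × Bool} (ht : W.head? = some t) {L : List (Bool × Bool)}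
    (hL : FreeGroup.IsReduced (L ++ [t])) {k : Bool} (hk : IsMono c N (L ++ [t]) k) :
    c (mk L * p⁻¹) = k := by
  obtain ⟨W', rfl⟩ : ∃ W', W = t :: W' := by
    cases W with
    | nil => simp at ht
    | cons a W => exact ⟨W, by simpa using ht⟩
  set n := N + FreeGroup.norm p
  set V := (replicate (n + 1) (t :: W')).flatten with hV
  obtain ⟨V', hV'⟩ : ∃ V', V = [t] ++ V' := ⟨W' ++ (replicate n (t :: W')).flatten, by
    simp [hV, replicate_succ]⟩
  have hVr : FreeGroup.IsReduced V := (hW.flatten_replicate _).isReduced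
  have hlen : n + 1 ≤ V.length := by
    simp only [hV, length_flatten, map_replicate, sum_replicate, length_cons, smul_eq_mul]
    nlinarith [Nat.zero_le W'.length]
  have hLV : FreeGroup.IsReduced (L ++ V) := by
    rw [hV', ← append_assoc]
    exact hL.append_overlap (hV' ▸ hVr) (by simp)
  have hnorm : n ≤ FreeGroup.norm (mk (L ++ V)) := by
    rw [FreeGroup.IsReduced.norm_mk hLV, length_append]; omega
  have h1 : c (mk (L ++ V)) = k := by
    have h := hk V' (by rw [append_assoc, ← hV']; exact hLV)
      (by rw [append_assoc, ← hV', length_append]; omega)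
    rwa [append_assoc, ← hV'] at h
  have h2 : mk (L ++ V) * p⁻¹ = mk L * p⁻¹ * w ^ (n + 1) := by
    rw [← mul_mk, hV, ← pow_mk, hp]
    have := conj_pow (i := n + 1) (a := p⁻¹) (b := w)
    rw [inv_inv] at this
    rw [this]
    group
  rw [← h1, ← apply_mul_of_norm_le hN p⁻¹ (mk (L ++ V)) (by rw [norm_inv_eq]; exact hnorm), h2,
    apply_mul_pow hw]

theorem mk_rotate_eq_conj {α : Type*} {W W' : List (α × Bool)} (h : W ~r W') :
    ∃ p : FreeGroup α, mk W' = p⁻¹ * mk W * p := by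
  obtain ⟨p, q, rfl, rfl⟩ := exists_append_of_isRotated h
  refine ⟨mk p, ?_⟩
  rw [← mul_mk, ← mul_mk]
  group

theorem color_eq_of_cyclicAdj {c : F2 → Bool} {N : ℕ}
    (hN : ∀ g s, N ≤ FreeGroup.norm g → c (g * mk [s]) = c g) {W : List (Bool × Bool)}
    (hw : ∀ g, c (g * mk W) = c g) (hW : IsCyclicallyReduced W) {x t : Bool × Bool}
    (hadj : CyclicAdj W x t) {L : List (Bool × Bool)}
    (hs : FreeGroup.IsReduced (L ++ [(x.1, !x.2)])) (ht : FreeGroup.IsReduced (L ++ [t]))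
    {k k' : Bool} (hk : IsMono c N (L ++ [(x.1, !x.2)]) k) (hk' : IsMono c N (L ++ [t]) k') :
    k = k' := by
  obtain ⟨u, hu, hhead⟩ := hadj
  have hU := isCyclicallyReduced_of_isRotated hW hu
  obtain ⟨p, hp⟩ := mk_rotate_eq_conj hu
  rw [← color_eq_of_ray hN hw hU hp hhead ht hk']
  symm
  have hw' : ∀ g, c (g * (mk W)⁻¹) = c g := fun g => by
    rw [← hw, inv_mul_cancel_right]
  refine color_eq_of_ray hN hw' (isCyclicallyReduced_invRev hU) (p := p) ?_ ?_ hs hk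
  · rw [← inv_mk, hp]; group
  · simp [invRev]

theorem isMono_of_le {c : F2 → Bool} {N : ℕ}
    (hN : ∀ g s, N ≤ FreeGroup.norm g → c (g * mk [s]) = c g) {L : List (Bool × Bool)}
    (hlen : N ≤ L.length) : IsMono c N L (c (mk L)) := by
  intro L'
  induction L' using List.reverseRecOn with
  | nil => simp
  | append_singleton L' s ih =>
    intro hr _
    rw [← append_assoc] at hr ⊢
    have hr' : FreeGroup.IsReduced (L ++ L') := hr.infix ⟨[], [s], by simp⟩
    have hlen' : N ≤ (L ++ L').length := by rw [length_append]; omega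
    rw [← mul_mk, hN _ _ (by rw [FreeGroup.IsReduced.norm_mk hr']; exact hlen'), ih hr' hlen']

/-- The letters `s`, `t` are joined in the Whitehead graph of the cyclic word `W`. -/
def IsTurn (W : List (Bool × Bool)) (s t : Bool × Bool) : Prop :=
  CyclicAdj W (s.1, !s.2) t ∨ CyclicAdj W (t.1, !t.2) s

/-- The Whitehead graph of `W` stays connected after deleting a vertex. -/
def IsTwoConnected (W : List (Bool × Bool)) : Prop :=
  ∀ (z : Bool × Bool) (f : Bool × Bool → Bool),
    (∀ s t, s ≠ z → t ≠ z → IsTurn W s t → f s = f t) → ∀ s t, s ≠ z → t ≠ z → f s = f t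

theorem color_eq_of_isTurn {c : F2 → Bool} {N : ℕ}
    (hN : ∀ g s, N ≤ FreeGroup.norm g → c (g * mk [s]) = c g) {W : List (Bool × Bool)}
    (hw : ∀ g, c (g * mk W) = c g) (hW : IsCyclicallyReduced W) {s t : Bool × Bool}
    (h : IsTurn W s t) {L : List (Bool × Bool)}
    (hs : FreeGroup.IsReduced (L ++ [s])) (ht : FreeGroup.IsReduced (L ++ [t])) {k k' : Bool}
    (hk : IsMono c N (L ++ [s]) k) (hk' : IsMono c N (L ++ [t]) k') :
    k = k' := by
  rcases h with h | h
  · exact color_eq_of_cyclicAdj hN hw hW h (by simpa using hs) ht (by simpa using hk) hk'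
  · exact (color_eq_of_cyclicAdj hN hw hW h (by simpa using ht) hs (by simpa using hk') hk).symm

theorem exists_isMono {c : F2 → Bool} {N : ℕ}
    (hN : ∀ g s, N ≤ FreeGroup.norm g → c (g * mk [s]) = c g) {W : List (Bool × Bool)}
    (hw : ∀ g, c (g * mk W) = c g) (hW : IsCyclicallyReduced W) (hconn : IsTwoConnected W)
    (d : ℕ) : ∀ (L : List (Bool × Bool)) (x : Bool × Bool), FreeGroup.IsReduced (L ++ [x]) →
      N ≤ L.length + 1 + d → ∃ k, IsMono c N (L ++ [x]) k := by
  induction d with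
  | zero => exact fun L x _ hlen => ⟨_, isMono_of_le hN (by simpa using hlen)⟩
  | succ d ih =>
    intro L x hr hlen
    by_cases hlong : N ≤ L.length + 1
    · exact ⟨_, isMono_of_le hN (by simpa using hlong)⟩
    have hred : ∀ s, s ≠ (x.1, !x.2) → FreeGroup.IsReduced (L ++ [x] ++ [s]) := by
      intro s hs
      unfold FreeGroup.IsReduced
      rw [isChain_append]
      refine ⟨hr, by simp, ?_⟩
      intro a ha b hb hab
      simp only [getLast?_append, getLast?_singleton, Option.some_or, Option.mem_def,
        Option.some.injEq, head?_cons] at ha hb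
      subst ha hb
      by_contra hne
      exact hs (Prod.ext hab.symm (by simp only; cases h1 : x.2 <;> cases h2 : s.2 <;> simp_all))
    have hex : ∀ s, ∃ k, s ≠ (x.1, !x.2) → IsMono c N (L ++ [x] ++ [s]) k := by
      intro s
      by_cases hs : s = (x.1, !x.2)
      · exact ⟨true, fun h => absurd hs h⟩
      · obtain ⟨k, hk⟩ := ih (L ++ [x]) s (hred s hs) (by
          simp only [length_append, length_cons, length_nil]; omega)
        exact ⟨k, fun _ => hk⟩
    choose f hf using hex
    have hall := hconn (x.1, !x.2) f fun s t hs ht hst =>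
      color_eq_of_isTurn hN hw hW hst (hred s hs) (hred t ht) (hf s hs) (hf t ht)
    refine ⟨f x, ?_⟩
    intro L' hL' hlen'
    cases L' with
    | nil => simp only [append_nil, length_append, length_cons, length_nil] at hlen'; omega
    | cons s L' =>
      have hL'' : L ++ [x] ++ s :: L' = L ++ [x] ++ [s] ++ L' := by simp
      have hs : s ≠ (x.1, !x.2) := by
        rintro rfl
        have h := hL'.infix (L₁ := [x, (x.1, !x.2)]) ⟨L, L', by simp⟩
        simp at h
      have hx : x ≠ (x.1, !x.2) := fun h => by simpa using congrArg Prod.snd h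
      rw [hall x s hx hs]
      rw [hL''] at hL' hlen' ⊢
      exact hf s hs L' hL' hlen'

theorem color_const_of_isTwoConnected {c : F2 → Bool} {N : ℕ}
    (hN : ∀ g s, N ≤ FreeGroup.norm g → c (g * mk [s]) = c g) {W : List (Bool × Bool)}
    (hw : ∀ g, c (g * mk W) = c g) (hW : IsCyclicallyReduced W) (hconn : IsTwoConnected W)
    {g h : F2} (hg : N + 1 ≤ FreeGroup.norm g) (hh : N + 1 ≤ FreeGroup.norm h) : c g = c h := by
  have hex : ∀ s, ∃ k, IsMono c N ([] ++ [s]) k := fun s =>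
    exists_isMono hN hw hW hconn N [] s (by simp) (by simp)
  choose f hf using hex
  have hturn : ∀ s t, IsTurn W s t → f s = f t := fun s t hst =>
    color_eq_of_isTurn hN hw hW hst (by simp) (by simp) (hf s) (hf t)
  have hall : ∀ s t, f s = f t := by
    intro s t
    obtain ⟨z, hsz, htz⟩ : ∃ z, s ≠ z ∧ t ≠ z := by revert s t; decide
    exact hconn z f (fun s t _ _ => hturn s t) s t hsz htz
  have key : ∀ g : F2, N + 1 ≤ FreeGroup.norm g → c g = f (true, true) := by
    intro g hg
    have hr := isReduced_toWord (x := g)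
    rw [FreeGroup.norm] at hg
    rw [← mk_toWord (x := g)]
    generalize g.toWord = L at hr hg ⊢
    cases L with
    | nil => simp at hg
    | cons s L => rw [hall _ s]; exact hf s L hr (by simp at hg ⊢; omega)
  rw [key g hg, key h hh]

theorem head_toWord_mul_mk (h : F2) (s : Bool × Bool) (hh : 2 ≤ FreeGroup.norm h) :
    (h * mk [s]).toWord.head? = h.toWord.head? := by
  have hr := isReduced_toWord (x := h)
  rw [FreeGroup.norm] at hh
  nth_rw 1 [← mk_toWord (x := h)]
  generalize h.toWord = L at hr hh ⊢
  rw [mul_mk, toWord_mk]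
  rcases eq_nil_or_concat' L with rfl | ⟨L, t, rfl⟩
  · simp at hh
  have hne : L ≠ [] := by rintro rfl; simp at hh
  have hL : FreeGroup.IsReduced L := hr.infix ⟨[], [t], by simp⟩
  by_cases hst : t.1 = s.1 → t.2 = s.2
  · have : FreeGroup.IsReduced (L ++ [t] ++ [s]) := by
      rw [append_assoc]
      exact append_assoc L [t] [s] ▸ hr.append_overlap (by simpa using hst) (by simp)
    rw [this.reduce_eq]
    simp
  · obtain ⟨t1, t2⟩ := t
    obtain ⟨s1, s2⟩ := s
    simp only [Classical.not_imp] at hst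
    obtain ⟨rfl, h2⟩ := hst
    obtain rfl : s2 = !t2 := by cases s2 <;> cases t2 <;> simp_all
    have : reduce (L ++ [(t1, t2)] ++ [(t1, !t2)]) = reduce L :=
      reduce.Step.eq (by simpa using Red.Step.not (L₁ := L) (L₂ := []) (x := t1) (b := t2))
    rw [this, hL.reduce_eq, head?_append_of_ne_nil _ hne]

theorem head_toWord_mul_of (h : F2) (b : Bool) :
    (h * FreeGroup.of b).toWord.head? = some (!b, true) ↔
      h.toWord.head? = some (!b, true) := by
  by_cases hh : 2 ≤ FreeGroup.norm h
  · rw [FreeGroup.of, head_toWord_mul_mk h _ hh]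
  · have hr := isReduced_toWord (x := h)
    rw [FreeGroup.norm] at hh
    nth_rw 1 [← mk_toWord (x := h)]
    generalize h.toWord = L at hr hh ⊢
    rw [FreeGroup.of, mul_mk, toWord_mk]
    match L with
    | [] => revert b; decide
    | [s] => clear hh hr; revert s b; decide
    | _ :: _ :: _ => simp at hh

theorem exists_coloring {w : F2} (hw : IsBasisElement w) :
    ∃ (c : F2 → Bool) (N : ℕ), (∀ g, c (g * w) = c g) ∧
      (∀ g s, N ≤ FreeGroup.norm g → c (g * mk [s]) = c g) ∧
      ∀ M, ∃ g h, M ≤ FreeGroup.norm g ∧ M ≤ FreeGroup.norm h ∧ c g ≠ c h := by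
  obtain ⟨b, e, rfl⟩ := hw
  let c₀ : F2 → Bool := fun h => decide (h.toWord.head? = some (!b, true))
  have hc₀ : ∀ g s, 2 ≤ FreeGroup.norm g → c₀ (g * mk [s]) = c₀ g := fun g s hg => by
    simp only [c₀, head_toWord_mul_mk g s hg]
  obtain ⟨K, hK⟩ : ∃ K, ∀ s : Bool × Bool, FreeGroup.norm (e.symm (mk [s])) ≤ K :=
    ⟨_, fun s => Finset.le_sup (f := fun s => FreeGroup.norm (e.symm (mk [s]))) (Finset.mem_univ s)⟩
  obtain ⟨N, hN⟩ : ∃ N, ∀ g, N ≤ FreeGroup.norm g → 2 + K ≤ FreeGroup.norm (e.symm g) := by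
    have hfin : {g : F2 | FreeGroup.norm (e.symm g) < 2 + K}.Finite :=
      (finite_norm_lt (2 + K)).preimage e.symm.injective.injOn
    obtain ⟨N, hN⟩ := (hfin.image FreeGroup.norm).bddAbove
    refine ⟨N + 1, fun g hg => ?_⟩
    by_contra! hlt
    have := hN ⟨g, hlt, rfl⟩
    omega
  refine ⟨fun g => c₀ (e.symm g), N, ?_, ?_, ?_⟩
  · intro g
    simp only [c₀, map_mul, MulEquiv.symm_apply_apply, head_toWord_mul_of]
  · intro g s hg
    simp only [map_mul]
    exact apply_mul_of_norm_le hc₀ _ _ ((Nat.add_le_add_left (hK s) 2).trans (hN g hg))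
  · intro M
    have hfar : ∀ f : ℕ → F2, Function.Injective f → ∃ n, n ≠ 0 ∧ M ≤ FreeGroup.norm (f n) := by
      intro f hf
      by_contra! hlt
      refine Set.infinite_of_injective_forall_mem (f := fun n => f (n + 1))
        (fun m n h => by simpa using hf h) (fun n => ?_) (finite_norm_lt M)
      exact hlt (n + 1) (by simp)
    have hpow : Function.Injective fun n : ℕ => (FreeGroup.of (!b) : F2) ^ n := fun m n h => by
      simpa using congrArg FreeGroup.norm h
    obtain ⟨m, hm, hmM⟩ := hfar (fun n => e (FreeGroup.of (!b) ^ n)) (e.injective.comp hpow)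
    obtain ⟨n, hn, hnM⟩ := hfar (fun n => e (FreeGroup.of (!b) ^ n)⁻¹)
      (e.injective.comp (inv_injective.comp hpow))
    refine ⟨_, _, hmM, hnM, ?_⟩
    simp [c₀, toWord_inv, toWord_of_pow, invRev, hm, hn, head?_replicate]

end Coloring

/-- Whitehead: the graph of a cyclically reduced primitive word has a cut vertex. -/
theorem not_isTwoConnected {W : List (Bool × Bool)} (hW : IsCyclicallyReduced W)
    (hprim : IsBasisElement (mk W)) : ¬ IsTwoConnected W := by
  intro hconn
  obtain ⟨c, N, hw, hN, hne⟩ := exists_coloring hprim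
  obtain ⟨g, h, hg, hh, hgh⟩ := hne (N + 1)
  exact hgh (color_const_of_isTwoConnected hN hw hW hconn hg hh)

theorem IsTurn.symm {W : List (Bool × Bool)} {s t : Bool × Bool} (h : IsTurn W s t) :
    IsTurn W t s := Or.symm h

theorem IsTurn.of_cyclicAdj {W : List (Bool × Bool)} {b b' x y : Bool}
    (h : CyclicAdj W (b, x) (b', y)) : IsTurn W (b, !x) (b', y) := by
  left; simpa using h

theorem isTwoConnected_of_cycle {W : List (Bool × Bool)} {s₁ s₂ s₃ s₄ : Bool × Bool}
    (hnodup : [s₁, s₂, s₃, s₄].Nodup) (h₁ : IsTurn W s₁ s₂) (h₂ : IsTurn W s₂ s₃)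
    (h₃ : IsTurn W s₃ s₄) (h₄ : IsTurn W s₄ s₁) : IsTwoConnected W := by
  have hcover : ∀ z, z = s₁ ∨ z = s₂ ∨ z = s₃ ∨ z = s₄ := by
    clear h₁ h₂ h₃ h₄
    revert s₁ s₂ s₃ s₄
    decide
  intro z f hf
  have e₁ := fun h h' => hf s₁ s₂ h h' h₁
  have e₂ := fun h h' => hf s₂ s₃ h h' h₂
  have e₃ := fun h h' => hf s₃ s₄ h h' h₃
  have e₄ := fun h h' => hf s₄ s₁ h h' h₄
  intro s t hs ht
  have hz := hcover z
  have hs' := hcover s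
  have ht' := hcover t
  clear hcover hf
  simp only [nodup_cons, mem_cons, not_mem_nil, or_false, not_or, not_false_eq_true, nodup_nil,
    and_true] at hnodup
  grind

theorem not_isBasisElement_of_squares {W : List (Bool × Bool)} (hpos : ∀ s ∈ W, s.2 = true)
    (hA : CyclicAdj W (true, true) (true, true)) (hB : CyclicAdj W (false, true) (false, true)) :
    ¬ IsBasisElement (mk W) := by
  have hchange : ∀ b : Bool, CyclicAdj W (b, true) (!b, true) := by
    intro b
    have hb : (b, true) ∈ W ∧ (!b, true) ∈ W := by
      cases b
      · exact ⟨hB.mem.1, hA.mem.1⟩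
      · exact ⟨hA.mem.1, hB.mem.1⟩
    obtain ⟨x, y, hxy, hx, hy⟩ :=
      exists_cyclicAdj_of_change (fun s => s.1 = b) hb.1 hb.2 rfl (by simp)
    have h1 : x = (b, true) := Prod.ext hx (hpos x hxy.mem.1)
    have h2 : y = (!b, true) :=
      Prod.ext (Bool.eq_not_of_ne hy) (hpos y hxy.mem.2)
    rwa [h1, h2] at hxy
  have hW : IsCyclicallyReduced W := by
    refine ⟨?_, fun a ha b hb _ => ?_⟩
    · exact Pairwise.isChain (pairwise_of_forall_mem_list fun a ha b hb _ => by
        rw [hpos a ha, hpos b hb])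
    · rw [hpos a (mem_of_mem_getLast? ha), hpos b (mem_of_mem_head? hb)]
  intro hprim
  refine not_isTwoConnected hW hprim (isTwoConnected_of_cycle
    (s₁ := (true, false)) (s₂ := (false, true)) (s₃ := (false, false)) (s₄ := (true, true))
    (by decide) ?_ ?_ ?_ ?_)
  · exact .of_cyclicAdj (hchange true)
  · exact (IsTurn.of_cyclicAdj hB).symm
  · exact .of_cyclicAdj (hchange false)
  · exact (IsTurn.of_cyclicAdj hA).symm

section Syllables

/-- The word `b ^ m`. -/
def powerWord (b : Bool) (m : ℤ) : List (Bool × Bool) := replicate m.natAbs (b, decide (0 < m))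

/-- The word `A ^ m₁ B ^ n₁ ⋯ A ^ m_j B ^ n_j` with exponents listed in `l`. -/
def syllableWord (l : List (ℤ × ℤ)) : List (Bool × Bool) :=
  l.flatMap fun x => powerWord true x.1 ++ powerWord false x.2

theorem mk_powerWord (b : Bool) (m : ℤ) : mk (powerWord b m) = FreeGroup.of b ^ m := by
  have hrep : ∀ (n : ℕ) (ε : Bool), mk (replicate n (b, ε)) = mk [(b, ε)] ^ n := fun n ε => by
    rw [pow_mk]; simp
  rw [powerWord, hrep]
  rcases lt_or_ge 0 m with h | h
  · lift m to ℕ using h.le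
    simp only [h, decide_true, Int.natAbs_natCast, zpow_natCast]
    rfl
  · obtain ⟨n, rfl⟩ := Int.exists_eq_neg_ofNat h
    simp only [not_lt.2 h, decide_false, Int.natAbs_neg, Int.natAbs_natCast, zpow_neg,
      zpow_natCast, ← inv_pow]
    rfl

theorem mk_syllableWord (l : List (ℤ × ℤ)) :
    mk (syllableWord l) = (l.map fun x => A ^ x.1 * B ^ x.2).prod := by
  induction l with
  | nil => rfl
  | cons x l ih =>
    rw [map_cons, prod_cons, ← ih, syllableWord, flatMap_cons, ← mul_mk, ← mul_mk, mk_powerWord,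
      mk_powerWord]
    rfl

theorem isRotated_syllableWord {l l' : List (ℤ × ℤ)} (h : l ~r l') :
    syllableWord l ~r syllableWord l' := by
  obtain ⟨p, q, rfl, rfl⟩ := exists_append_of_isRotated h
  simp only [syllableWord, flatMap_append]
  exact isRotated_append

theorem powerWord_eq_cons {b : Bool} {m : ℤ} (h : m ≠ 0) :
    ∃ u, powerWord b m = (b, decide (0 < m)) :: u := by
  obtain ⟨k, hk⟩ := Nat.exists_eq_succ_of_ne_zero (Int.natAbs_ne_zero.2 h)
  exact ⟨replicate k (b, decide (0 < m)), by rw [powerWord, hk, replicate_succ]⟩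

theorem powerWord_eq_concat {b : Bool} {m : ℤ} (h : m ≠ 0) :
    ∃ u, powerWord b m = u ++ [(b, decide (0 < m))] := by
  obtain ⟨k, hk⟩ := Nat.exists_eq_succ_of_ne_zero (Int.natAbs_ne_zero.2 h)
  exact ⟨replicate k (b, decide (0 < m)), by rw [powerWord, hk, replicate_succ']⟩

theorem powerWord_eq_cons_cons {b : Bool} {m : ℤ} (h : 2 ≤ m) :
    ∃ u, powerWord b m = (b, true) :: (b, true) :: u := by
  obtain ⟨k, rfl⟩ := Int.eq_ofNat_of_zero_le (sub_nonneg.2 h) |>.imp fun k hk =>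
    (show m = ((k + 2 : ℕ) : ℤ) by push_cast; omega)
  refine ⟨replicate k (b, true), ?_⟩
  have : (0 : ℤ) < ((k + 2 : ℕ) : ℤ) := by omega
  rw [powerWord, decide_eq_true this, Int.natAbs_natCast]
  rfl

theorem isReduced_powerWord (b : Bool) (m : ℤ) : FreeGroup.IsReduced (powerWord b m) :=
  isChain_replicate_of_rel _ fun _ => rfl

theorem isCyclicallyReduced_syllableWord {l : List (ℤ × ℤ)}
    (hl : ∀ x ∈ l, x.1 ≠ 0 ∧ x.2 ≠ 0) : IsCyclicallyReduced (syllableWord l) := by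
  have hhead : ∀ l : List (ℤ × ℤ), (∀ x ∈ l, x.1 ≠ 0 ∧ x.2 ≠ 0) →
      ∀ s ∈ (syllableWord l).head?, s.1 = true := by
    rintro (_ | ⟨x, l⟩) hl s hs
    · simp [syllableWord] at hs
    · obtain ⟨u, hu⟩ := powerWord_eq_cons (b := true) (hl x (by simp)).1
      simp only [syllableWord, flatMap_cons, hu, cons_append, head?_cons, Option.mem_def,
        Option.some.injEq] at hs
      rw [← hs]
  have hlast : ∀ s ∈ (syllableWord l).getLast?, s.1 = false := by
    rcases eq_nil_or_concat' l with rfl | ⟨l, x, rfl⟩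
    · simp [syllableWord]
    · obtain ⟨u, hu⟩ := powerWord_eq_concat (b := false) (hl x (by simp)).2
      intro s hs
      simp only [syllableWord, flatMap_append, flatMap_cons, flatMap_nil, append_nil, hu,
        ← append_assoc, getLast?_append, getLast?_singleton, Option.some_or, Option.mem_def,
        Option.some.injEq] at hs
      rw [← hs]
  refine ⟨?_, fun a ha b hb hab => ?_⟩
  · clear hlast
    induction l with
    | nil => simp [syllableWord]
    | cons x l ih =>
      have hl' := fun y hy => hl y (mem_cons_of_mem x hy)
      have hsyl : FreeGroup.IsReduced (powerWord true x.1 ++ powerWord false x.2) := by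
        refine (isReduced_powerWord _ _).append (isReduced_powerWord _ _) fun a ha b hb hab => ?_
        have h1 := eq_of_mem_replicate (mem_of_mem_getLast? ha)
        have h2 := eq_of_mem_replicate (mem_of_mem_head? hb)
        simp [h1, h2] at hab
      refine hsyl.append (ih hl') fun a ha b hb hab => ?_
      have h2 := hhead l hl' b hb
      obtain ⟨u, hu⟩ := powerWord_eq_concat (b := false) (hl x (by simp)).2
      simp only [hu, ← append_assoc, getLast?_append, getLast?_singleton, Option.some_or,
        Option.mem_def, Option.some.injEq] at ha
      simp [← ha, h2] at hab
  · rw [hlast a ha, hhead l hl b hb] at hab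
    exact absurd hab (by simp)

theorem cyclicAdj_within_syllable {l : List (ℤ × ℤ)} {x : ℤ × ℤ} (hx : x ∈ l) (h1 : x.1 ≠ 0)
    (h2 : x.2 ≠ 0) :
    CyclicAdj (syllableWord l) (true, decide (0 < x.1)) (false, decide (0 < x.2)) := by
  obtain ⟨p, q, rfl⟩ := append_of_mem hx
  obtain ⟨u, hu⟩ := powerWord_eq_concat (b := true) h1
  obtain ⟨v, hv⟩ := powerWord_eq_cons (b := false) h2
  exact CyclicAdj.of_split (p := syllableWord p ++ u) (q := v ++ syllableWord q)
    (by simp [syllableWord, hu, hv])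

theorem cyclicAdj_between_syllables {l : List (ℤ × ℤ)} {x y : ℤ × ℤ} (hxy : CyclicAdj l x y)
    (h2 : x.2 ≠ 0) (h1 : y.1 ≠ 0) :
    CyclicAdj (syllableWord l) (false, decide (0 < x.2)) (true, decide (0 < y.1)) := by
  obtain ⟨t, ht, hh⟩ := hxy
  obtain ⟨u, hu⟩ := powerWord_eq_concat (b := false) h2
  obtain ⟨v, hv⟩ := powerWord_eq_cons (b := true) h1
  refine ⟨syllableWord t ++ powerWord true x.1 ++ u, ?_, ?_⟩
  · convert isRotated_syllableWord ht using 1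
    simp [syllableWord, hu]
  · have : syllableWord t ++ powerWord true x.1 ++ u ++ [(false, decide (0 < x.2))] =
        syllableWord (t ++ [x]) := by simp [syllableWord, hu]
    rw [this]
    obtain ⟨t', ht'⟩ := head?_eq_some_iff.1 hh
    rw [ht', syllableWord, flatMap_cons, hv]
    rfl

theorem cyclicAdj_square_fst {l : List (ℤ × ℤ)} {x : ℤ × ℤ} (hx : x ∈ l) (h : 2 ≤ x.1) :
    CyclicAdj (syllableWord l) (true, true) (true, true) := by
  obtain ⟨p, q, rfl⟩ := append_of_mem hx
  obtain ⟨u, hu⟩ := powerWord_eq_cons_cons (b := true) h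
  exact CyclicAdj.of_split (p := syllableWord p)
    (q := u ++ powerWord false x.2 ++ syllableWord q) (by simp [syllableWord, hu])

theorem cyclicAdj_square_snd {l : List (ℤ × ℤ)} {x : ℤ × ℤ} (hx : x ∈ l) (h : 2 ≤ x.2) :
    CyclicAdj (syllableWord l) (false, true) (false, true) := by
  obtain ⟨p, q, rfl⟩ := append_of_mem hx
  obtain ⟨u, hu⟩ := powerWord_eq_cons_cons (b := false) h
  exact CyclicAdj.of_split (p := syllableWord p ++ powerWord true x.1)
    (q := u ++ syllableWord q) (by simp [syllableWord, hu])

theorem snd_eq_true_of_mem_syllableWord {l : List (ℤ × ℤ)} (hl : ∀ x ∈ l, 0 ≤ x.1 ∧ 0 ≤ x.2) :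
    ∀ s ∈ syllableWord l, s.2 = true := by
  intro s hs
  simp only [syllableWord, powerWord, mem_flatMap, mem_append, mem_replicate] at hs
  obtain ⟨x, hx, ⟨h, rfl⟩ | ⟨h, rfl⟩⟩ := hs
  · have := (hl x hx).1
    exact decide_eq_true (by omega)
  · have := (hl x hx).2
    exact decide_eq_true (by omega)

theorem fst_pos_of_isBasisElement {l : List (ℤ × ℤ)} (hl : ∀ x ∈ l, x.1 ≠ 0 ∧ x.2 ≠ 0)
    (hprim : IsBasisElement (mk (syllableWord l))) {x y : ℤ × ℤ} (hx : x ∈ l) (hy : y ∈ l)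
    (hpos : 0 < x.1) : 0 < y.1 := by
  by_contra hneg
  have key : ∀ {u v : ℤ × ℤ} {ε : Bool}, CyclicAdj l u v → decide (0 < u.1) = ε →
      decide (0 < v.1) = !ε → ∀ δ, IsTurn (syllableWord l) (true, !ε) (false, δ) := by
    intro u v ε huv hu hv δ
    obtain ⟨hul, hvl⟩ := huv.mem
    have t1 := IsTurn.of_cyclicAdj (cyclicAdj_within_syllable hul (hl u hul).1 (hl u hul).2)
    have t2 := IsTurn.of_cyclicAdj
      (cyclicAdj_between_syllables huv (hl u hul).2 (hl v hvl).1)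
    rw [hu] at t1
    rw [hv] at t2
    rcases Bool.eq_or_eq_not δ (decide (0 < u.2)) with rfl | rfl
    · exact t1
    · exact t2.symm
  obtain ⟨u, v, huv, hu, hv⟩ := exists_cyclicAdj_of_change (fun z : ℤ × ℤ => 0 < z.1) hx hy hpos
    hneg
  obtain ⟨u', v', huv', hu', hv'⟩ := exists_cyclicAdj_of_change (fun z : ℤ × ℤ => ¬ 0 < z.1)
    hy hx hneg (not_not.2 hpos)
  have k1 := key huv (decide_eq_true hu) (decide_eq_false hv)
  have k2 := key huv' (decide_eq_false hu') (decide_eq_true (not_not.1 hv'))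
  exact not_isTwoConnected (isCyclicallyReduced_syllableWord hl) hprim
    (isTwoConnected_of_cycle (by decide) (k1 true) (k2 true).symm (k2 false) (k1 false).symm)

theorem snd_pos_of_isBasisElement {l : List (ℤ × ℤ)} (hl : ∀ x ∈ l, x.1 ≠ 0 ∧ x.2 ≠ 0)
    (hprim : IsBasisElement (mk (syllableWord l))) {x y : ℤ × ℤ} (hx : x ∈ l) (hy : y ∈ l)
    (hpos : 0 < x.2) : 0 < y.2 := by
  by_contra hneg
  have key : ∀ {u v : ℤ × ℤ} {ε : Bool}, CyclicAdj l u v → decide (0 < u.2) = ε →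
      decide (0 < v.2) = !ε → ∀ δ, IsTurn (syllableWord l) (false, !ε) (true, δ) := by
    intro u v ε huv hu hv δ
    obtain ⟨hul, hvl⟩ := huv.mem
    have t1 := IsTurn.of_cyclicAdj (cyclicAdj_within_syllable hvl (hl v hvl).1 (hl v hvl).2)
    have t2 := IsTurn.of_cyclicAdj
      (cyclicAdj_between_syllables huv (hl u hul).2 (hl v hvl).1)
    rw [hv] at t1
    rw [hu] at t2
    rcases Bool.eq_or_eq_not δ (decide (0 < v.1)) with rfl | rfl
    · exact t2
    · exact t1.symm
  obtain ⟨u, v, huv, hu, hv⟩ := exists_cyclicAdj_of_change (fun z : ℤ × ℤ => 0 < z.2) hx hy hpos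
    hneg
  obtain ⟨u', v', huv', hu', hv'⟩ := exists_cyclicAdj_of_change (fun z : ℤ × ℤ => ¬ 0 < z.2)
    hy hx hneg (not_not.2 hpos)
  have k1 := key huv (decide_eq_true hu) (decide_eq_false hv)
  have k2 := key huv' (decide_eq_false hu') (decide_eq_true (not_not.1 hv'))
  exact not_isTwoConnected (isCyclicallyReduced_syllableWord hl) hprim
    (isTwoConnected_of_cycle (by decide) (k1 true) (k2 true).symm (k2 false) (k1 false).symm)

theorem forall_eq_one_or_of_isBasisElement {l : List (ℤ × ℤ)} (hl : ∀ x ∈ l, 0 < x.1 ∧ 0 < x.2)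
    (hprim : IsBasisElement (mk (syllableWord l))) :
    (∀ x ∈ l, x.1 = 1) ∨ ∀ x ∈ l, x.2 = 1 := by
  by_contra! h
  obtain ⟨⟨x, hx, hx1⟩, y, hy, hy1⟩ := h
  refine not_isBasisElement_of_squares
    (snd_eq_true_of_mem_syllableWord fun z hz => ⟨(hl z hz).1.le, (hl z hz).2.le⟩)
    (cyclicAdj_square_fst hx ?_) (cyclicAdj_square_snd hy ?_) hprim
  · have := (hl x hx).1; omega
  · have := (hl y hy).2; omega

end Syllables

section Automorphisms

theorem IsBasisElement.map {w : F2} (h : IsBasisElement w) (φ : F2 ≃* F2) :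
    IsBasisElement (φ w) := by
  obtain ⟨b, e, rfl⟩ := h
  exact ⟨b, e.trans φ, rfl⟩

theorem IsPrimitive.isBasisElement {w : F2} (h : IsPrimitive w) : IsBasisElement w := by
  obtain ⟨x, y, ⟨e, hx, hy⟩, rfl | rfl⟩ := h
  · exact ⟨true, e, hx⟩
  · exact ⟨false, e, hy⟩

theorem exists_mulEquiv_of_lift_inverse {a b a' b' : F2}
    (h₁ : lift (fun i => cond i a' b') a = A) (h₂ : lift (fun i => cond i a' b') b = B)
    (h₃ : lift (fun i => cond i a b) a' = A) (h₄ : lift (fun i => cond i a b) b' = B) :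
    ∃ φ : F2 ≃* F2, φ A = a ∧ φ B = b := by
  refine ⟨MonoidHom.toMulEquiv (lift fun i => cond i a b) (lift fun i => cond i a' b') ?_ ?_,
    ?_, ?_⟩
  · ext i; cases i <;> simp [h₁, h₂, A, B]
  · ext i; cases i <;> simp [h₃, h₄, A, B]
  · exact lift_apply_of
  · exact lift_apply_of

theorem exists_mulEquiv_zpow {ε δ : ℤ} (hε : ε = 1 ∨ ε = -1) (hδ : δ = 1 ∨ δ = -1) :
    ∃ φ : F2 ≃* F2, φ A = A ^ ε ∧ φ B = B ^ δ := by
  apply exists_mulEquiv_of_lift_inverse (a' := A ^ ε) (b' := B ^ δ) <;>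
  rcases hε with rfl | rfl <;> rcases hδ with rfl | rfl <;> simp [A, B]

theorem exists_mulEquiv_shear (k : ℤ) : ∃ φ : F2 ≃* F2, φ A = A * B ^ (-k) ∧ φ B = B := by
  apply exists_mulEquiv_of_lift_inverse (a' := A * B ^ k) (b' := B) <;> simp [A, B]

theorem exists_mulEquiv_swap : ∃ φ : F2 ≃* F2, φ A = B ∧ φ B = A := by
  apply exists_mulEquiv_of_lift_inverse (a' := B) (b' := A) <;> simp [A, B]

theorem map_mk_syllableWord (φ : F2 ≃* F2) (l : List (ℤ × ℤ)) :
    φ (mk (syllableWord l)) = (l.map fun x => φ A ^ x.1 * φ B ^ x.2).prod := by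
  rw [mk_syllableWord, map_list_prod, List.map_map]
  congr 1
  exact List.map_congr_left fun x _ => by simp [map_zpow]

theorem isBasisElement_map_mul {l : List (ℤ × ℤ)} {ε δ : ℤ} (hε : ε = 1 ∨ ε = -1)
    (hδ : δ = 1 ∨ δ = -1) (h : IsBasisElement (mk (syllableWord l))) :
    IsBasisElement (mk (syllableWord (l.map fun x => (ε * x.1, δ * x.2)))) := by
  obtain ⟨φ, hA, hB⟩ := exists_mulEquiv_zpow hε hδ
  have := h.map φ
  rw [map_mk_syllableWord, hA, hB] at this
  rw [mk_syllableWord, List.map_map]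
  convert this using 4 with x
  simp [zpow_mul]

theorem isBasisElement_map_sub {l : List (ℤ × ℤ)} (hl : ∀ x ∈ l, x.1 = 1) (e : ℤ)
    (h : IsBasisElement (mk (syllableWord l))) :
    IsBasisElement (mk (syllableWord (l.map fun x => (1, x.2 - e)))) := by
  obtain ⟨φ, hA, hB⟩ := exists_mulEquiv_shear e
  have := h.map φ
  rw [map_mk_syllableWord, hA, hB] at this
  rw [mk_syllableWord, List.map_map]
  convert this using 2
  refine List.map_congr_left fun x hx => ?_
  rw [hl x hx, zpow_one, mul_assoc, ← zpow_add]
  simp [sub_eq_neg_add]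

theorem isBasisElement_map_swap {l : List (ℤ × ℤ)} (hl : ∀ x ∈ l, x.2 = 1)
    (h : IsBasisElement (mk (syllableWord l))) :
    IsBasisElement (mk (syllableWord (l.map Prod.swap))) := by
  obtain ⟨φ, hA, hB⟩ := exists_mulEquiv_swap
  have h' := (h.map φ).map (MulAut.conj A)
  rw [map_mk_syllableWord, hA, hB, MulAut.conj_apply] at h'
  convert h'
  rw [mk_syllableWord, eq_mul_inv_iff_mul_eq]
  clear h h'
  induction l with
  | nil => simp
  | cons x l ih =>
    simp only [List.map_cons, prod_cons, Prod.fst_swap, Prod.snd_swap, hl x (by simp), zpow_one,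
      mul_assoc] at ih ⊢
    rw [ih fun y hy => hl y (mem_cons_of_mem x hy)]

end Automorphisms

theorem exists_snd_eq_or_eq_add_one {l : List (ℤ × ℤ)} (hne : l ≠ [])
    (hl : ∀ x ∈ l, x.1 = 1 ∧ 0 < x.2) (hprim : IsBasisElement (mk (syllableWord l))) :
    ∃ e : ℤ, 0 < e ∧ ∀ x ∈ l, x.2 = e ∨ x.2 = e + 1 := by
  obtain ⟨a, ha, hmin⟩ := l.toFinset.exists_min_image Prod.snd
    (by simpa [Finset.nonempty_iff_ne_empty] using hne)
  simp only [mem_toFinset] at ha hmin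
  refine ⟨a.2, (hl a ha).2, fun x hx => ?_⟩
  by_contra hcon
  have hxa := hmin x hx
  set l' := l.map fun x => ((1 : ℤ), x.2 - a.2)
  have hxl' : (1, x.2 - a.2) ∈ l' := mem_map.2 ⟨x, hx, rfl⟩
  have hal' : (1, 0) ∈ l' := mem_map.2 ⟨a, ha, by simp⟩
  have hone : ∀ z ∈ l', z.1 = 1 ∧ 0 ≤ z.2 := by
    intro z hz
    obtain ⟨y, hy, rfl⟩ := mem_map.1 hz
    exact ⟨rfl, sub_nonneg.2 (hmin y hy)⟩
  have hAA : CyclicAdj (syllableWord l') (true, true) (true, true) := by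
    obtain ⟨t, ht⟩ := isRotated_cons_of_mem hal'
    refine CyclicAdj.of_isRotated (isRotated_syllableWord ht) ?_
    rcases t with _ | ⟨⟨m, n⟩, t⟩
    · have := ht.mem_iff.1 hxl'
      simp only [mem_singleton, Prod.mk.injEq, true_and] at this
      omega
    · obtain rfl : m = 1 := (hone (m, n) (ht.mem_iff.2 (by simp))).1
      exact CyclicAdj.of_split (p := []) (q := powerWord false n ++ syllableWord t)
        (by simp [syllableWord, powerWord])
  exact not_isBasisElement_of_squares
    (snd_eq_true_of_mem_syllableWord fun z hz => ⟨by simp [(hone z hz).1], (hone z hz).2⟩)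
    hAA (cyclicAdj_square_snd hxl' (by simp only; omega))
    (isBasisElement_map_sub (fun y hy => (hl y hy).1) a.2 hprim)

end WhiteheadGraph

theorem stmt_1 (j : ℕ) (hj : 1 ≤ j) (m n : Fin j → ℤ)
    (hm : ∀ i, m i ≠ 0) (hn : ∀ i, n i ≠ 0)
    (w : F2) (hw : w = (List.ofFn fun i => A ^ (m i) * B ^ (n i)).prod)
    (hprim : ∃ u : F2, IsConj u w ∧ IsPrimitive u) :
    ∃ εA εB : ℤ, (εA = 1 ∨ εA = -1) ∧ (εB = 1 ∨ εB = -1) ∧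
      ∃ e : ℤ, 0 < e ∧
        (((∀ i, εA * m i = 1) ∧ (∀ i, εB * n i = e ∨ εB * n i = e + 1)) ∨
          ((∀ i, εB * n i = 1) ∧ (∀ i, εA * m i = e ∨ εA * m i = e + 1))) := by
  set l := List.ofFn fun i => (m i, n i) with hl
  have hmem : ∀ i, (m i, n i) ∈ l := fun i => List.mem_ofFn.2 ⟨i, rfl⟩
  have hne : ∀ x ∈ l, x.1 ≠ 0 ∧ x.2 ≠ 0 := by
    intro x hx
    obtain ⟨i, rfl⟩ := List.mem_ofFn.1 hx
    exact ⟨hm i, hn i⟩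
  have hbasis : IsBasisElement (FreeGroup.mk (syllableWord l)) := by
    have : FreeGroup.mk (syllableWord l) = w := by
      rw [mk_syllableWord, hw, hl, List.map_ofFn]
      rfl
    rw [this]
    obtain ⟨u, hu, hup⟩ := hprim
    obtain ⟨g, rfl⟩ := isConj_iff.1 hu
    exact hup.isBasisElement.map (MulAut.conj g)
  let i₀ : Fin j := ⟨0, hj⟩
  have hsign : ∀ f : Fin j → ℤ, (∀ i, f i ≠ 0) → (∀ i k, 0 < f i → 0 < f k) →
      ∃ ε : ℤ, (ε = 1 ∨ ε = -1) ∧ ∀ i, 0 < ε * f i := by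
    intro f hf hconst
    by_cases h : 0 < f i₀
    · exact ⟨1, .inl rfl, fun i => by simpa using hconst i₀ i h⟩
    · refine ⟨-1, .inr rfl, fun i => ?_⟩
      have : ¬ 0 < f i := fun h' => h (hconst i i₀ h')
      have := hf i
      omega
  obtain ⟨εA, hεA, hposA⟩ := hsign m hm fun i k =>
    fst_pos_of_isBasisElement hne hbasis (hmem i) (hmem k)
  obtain ⟨εB, hεB, hposB⟩ := hsign n hn fun i k =>
    snd_pos_of_isBasisElement hne hbasis (hmem i) (hmem k)
  refine ⟨εA, εB, hεA, hεB, ?_⟩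
  have hbasis' := isBasisElement_map_mul hεA hεB hbasis
  set l' := l.map fun x => (εA * x.1, εB * x.2)
  have hmem' : ∀ i, (εA * m i, εB * n i) ∈ l' := fun i => List.mem_map.2 ⟨_, hmem i, rfl⟩
  have hne' : l' ≠ [] := List.ne_nil_of_mem (hmem' i₀)
  have hpos : ∀ x ∈ l', 0 < x.1 ∧ 0 < x.2 := by
    intro x hx
    obtain ⟨y, hy, rfl⟩ := List.mem_map.1 hx
    obtain ⟨i, rfl⟩ := List.mem_ofFn.1 hy
    exact ⟨hposA i, hposB i⟩
  rcases forall_eq_one_or_of_isBasisElement hpos hbasis' with h | h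
  · obtain ⟨e, he, hall⟩ :=
      exists_snd_eq_or_eq_add_one hne' (fun x hx => ⟨h x hx, (hpos x hx).2⟩) hbasis'
    exact ⟨e, he, .inl ⟨fun i => h _ (hmem' i), fun i => hall _ (hmem' i)⟩⟩
  · obtain ⟨e, he, hall⟩ := exists_snd_eq_or_eq_add_one (l := l'.map Prod.swap)
      (by simpa using hne') (by
        intro x hx
        obtain ⟨y, hy, rfl⟩ := List.mem_map.1 hx
        exact ⟨h y hy, (hpos y hy).1⟩) (isBasisElement_map_swap h hbasis')
    exact ⟨e, he, .inr ⟨fun i => h _ (hmem' i),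
      fun i => hall _ (List.mem_map.2 ⟨_, hmem' i, rfl⟩)⟩⟩
end

section
/- If w ∈ F(A,B) is primitive and lies in the normal closure of B, then w is conjugate to B or B⁻¹. -/
namespace FreeGroup

/-- The length of the longest common prefix of two lists. -/
def commonPrefixLength {β : Type*} [DecidableEq β] : List β → List β → ℕ
  | s :: l, t :: m => if s = t then commonPrefixLength l m + 1 else 0
  | _, _ => 0

theorem commonPrefixLength_comm {β : Type*} [DecidableEq β] :
    ∀ l m : List β, commonPrefixLength l m = commonPrefixLength m l
  | [], [] | [], _ :: _ | _ :: _, [] => rfl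
  | s :: l, t :: m => by
    simp only [commonPrefixLength, commonPrefixLength_comm l m, eq_comm]

theorem commonPrefixLength_le_left {β : Type*} [DecidableEq β] :
    ∀ l m : List β, commonPrefixLength l m ≤ l.length
  | [], _ | _ :: _, [] => by simp [commonPrefixLength]
  | s :: l, t :: m => by
    have := commonPrefixLength_le_left l m
    simp only [commonPrefixLength, List.length_cons]
    split_ifs <;> omega

theorem min_commonPrefixLength_le {β : Type*} [DecidableEq β] :
    ∀ l m n : List β,
      min (commonPrefixLength l m) (commonPrefixLength m n) ≤ commonPrefixLength l n
  | [], _, _ | _ :: _, [], _ | _ :: _, _ :: _, [] => by simp [commonPrefixLength]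
  | s :: l, t :: m, u :: n => by
    have := min_commonPrefixLength_le l m n
    simp only [commonPrefixLength]
    split_ifs <;> first | omega | simp_all

variable {α : Type*} [DecidableEq α]

theorem norm_inv_mk_mul_mk : ∀ l m : List (α × Bool), IsReduced l → IsReduced m →
    norm ((mk l)⁻¹ * mk m) + 2 * commonPrefixLength l m = l.length + m.length
  | [], m, _, hm => by
    rw [← one_eq_mk, inv_one, one_mul, norm, toWord_mk, hm.reduce_eq]
    simp [commonPrefixLength]
  | s :: l, [], hl, _ => by
    rw [← one_eq_mk, mul_one, norm_inv_eq, norm, toWord_mk, hl.reduce_eq]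
    simp [commonPrefixLength]
  | s :: l, t :: m, hl, hm => by
    by_cases h : s = t
    · subst h
      have ih := norm_inv_mk_mul_mk l m (hl.infix ⟨[s], [], by simp⟩) (hm.infix ⟨[s], [], by simp⟩)
      have key : (mk (s :: l))⁻¹ * mk (s :: m) = (mk l)⁻¹ * mk m := by
        rw [show s :: l = [s] ++ l from rfl, show s :: m = [s] ++ m from rfl, ← mul_mk, ← mul_mk]
        group
      rw [key]
      simp only [commonPrefixLength, if_true, List.length_cons]
      omega
    · have hinv : IsReduced (invRev (s :: l)) := by
        rw [isReduced_iff_reduce_eq, reduce_invRev, hl.reduce_eq]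
      have hred : IsReduced (invRev (s :: l) ++ t :: m) := by
        rw [invRev_cons] at hinv ⊢
        refine List.IsChain.append hinv hm ?_
        intro a ha b hb
        simp [invRev] at ha hb
        subst ha hb
        intro h1
        by_contra h2
        apply h
        ext
        · exact h1
        · revert h2; cases s.2 <;> cases t.2 <;> simp
      rw [inv_mk, mul_mk, norm, toWord_mk, hred.reduce_eq]
      simp [commonPrefixLength, h]

/-- The Gromov product of two elements of a free group, based at the identity of the Cayley tree. -/
def gromovProduct (g h : FreeGroup α) : ℕ := commonPrefixLength g.toWord h.toWord

theorem gromovProduct_comm (g h : FreeGroup α) : gromovProduct g h = gromovProduct h g :=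
  commonPrefixLength_comm _ _

theorem gromovProduct_le_left (g h : FreeGroup α) : gromovProduct g h ≤ norm g :=
  commonPrefixLength_le_left _ _

theorem min_gromovProduct_le (g h k : FreeGroup α) :
    min (gromovProduct g h) (gromovProduct h k) ≤ gromovProduct g k :=
  min_commonPrefixLength_le _ _ _

theorem norm_inv_mul_add (g h : FreeGroup α) :
    norm (g⁻¹ * h) + 2 * gromovProduct g h = norm g + norm h := by
  have := norm_inv_mk_mul_mk g.toWord h.toWord isReduced_toWord isReduced_toWord
  rwa [mk_toWord, mk_toWord] at this

theorem norm_mul_add (g h : FreeGroup α) :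
    norm (g * h) + 2 * gromovProduct g⁻¹ h = norm g + norm h := by
  simpa using norm_inv_mul_add g⁻¹ h

theorem exists_norm_eq_of_le (g : FreeGroup α) {k : ℕ} (hk : k ≤ norm g) :
    ∃ p : FreeGroup α, norm p = k ∧ norm (p⁻¹ * g) = norm g - k := by
  have hg : IsReduced (g.toWord.take k ++ g.toWord.drop k) := by
    rw [List.take_append_drop]; exact isReduced_toWord
  refine ⟨mk (g.toWord.take k), ?_, ?_⟩
  · rw [norm, toWord_mk,
      (hg.infix ⟨[], g.toWord.drop k, by simp⟩ : IsReduced (g.toWord.take k)).reduce_eq,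
      List.length_take]
    exact min_eq_left hk
  · have : (mk (g.toWord.take k))⁻¹ * g = mk (g.toWord.drop k) := by
      nth_rewrite 2 [← mk_toWord (x := g)]
      nth_rewrite 2 [← List.take_append_drop k g.toWord]
      rw [← mul_mk]
      group
    rw [this, norm, toWord_mk,
      (hg.infix ⟨g.toWord.take k, [], by simp⟩ : IsReduced (g.toWord.drop k)).reduce_eq,
      List.length_drop, norm]

theorem norm_lt_norm_mul_self {g : FreeGroup α} (hg : g ≠ 1) : norm g < norm (g * g) := by
  have h := reduceCyclically.reduce_flatten_replicate_succ (isReduced_toWord (x := g)) 1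
  have h2 : reduce (List.replicate (1 + 1) g.toWord).flatten = (g * g).toWord := by
    simp [toWord_mul, List.replicate]
  rw [h2] at h
  have h3 := reduceCyclically.conj_conjugator_reduceCyclically g.toWord
  have h4 : reduceCyclically g.toWord ≠ [] := by
    intro h4
    apply hg
    rw [h4, List.append_nil] at h3
    rw [← mk_toWord (x := g), ← h3, ← mul_mk, ← inv_mk, mul_inv_cancel]
  have h5 := List.length_pos_of_ne_nil h4
  rw [norm, norm, h]
  nth_rewrite 1 [← h3]
  simp
  omega

theorem two_mul_gromovProduct_inv_self_lt {g : FreeGroup α} (hg : g ≠ 1) :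
    2 * gromovProduct g⁻¹ g < norm g := by
  have := norm_mul_add g g
  have := norm_lt_norm_mul_self hg
  omega

end FreeGroup

namespace FreeGroup

variable {α β : Type*} [DecidableEq α]

/-- The value of a signed letter under an assignment of the generators. -/
def letter {G : Type*} [Group G] (f : β → G) (a : β × Bool) : G := cond a.2 (f a.1) (f a.1)⁻¹

/-- The Nielsen conditions on a family of elements of a free group: no letter is absorbed by one
neighbour by more than a half, nor completely absorbed by its two neighbours. -/
structure IsNielsenReduced (f : β → FreeGroup α) : Prop where
  ne_one : ∀ a, letter f a ≠ 1
  left : ∀ a b : β × Bool, (a.1 = b.1 → a.2 = b.2) →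
    2 * gromovProduct (letter f a)⁻¹ (letter f b) ≤ norm (letter f a)
  right : ∀ a b : β × Bool, (a.1 = b.1 → a.2 = b.2) →
    2 * gromovProduct (letter f a)⁻¹ (letter f b) ≤ norm (letter f b)
  middle : ∀ a b c : β × Bool, (a.1 = b.1 → a.2 = b.2) → (b.1 = c.1 → b.2 = c.2) →
    gromovProduct (letter f a)⁻¹ (letter f b) + gromovProduct (letter f b)⁻¹ (letter f c) <
      norm (letter f b)

theorem IsNielsenReduced.gromovProduct_prod {f : β → FreeGroup α} (hf : IsNielsenReduced f)
    (l : List (β × Bool)) : ∀ a b : β × Bool, IsReduced (a :: b :: l) →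
    gromovProduct (letter f a)⁻¹ ((b :: l).map (letter f)).prod =
      gromovProduct (letter f a)⁻¹ (letter f b) ∧
    1 + norm (letter f a) ≤ norm ((a :: b :: l).map (letter f)).prod +
      gromovProduct (letter f a)⁻¹ (letter f b) := by
  induction l with
  | nil =>
    intro a b h
    rw [isReduced_cons_cons] at h
    have h1 := hf.right a b h.1
    have h2 := norm_mul_add (letter f a) (letter f b)
    have h3 : norm (letter f b) ≠ 0 := by simpa using hf.ne_one b
    simp
    omega
  | cons c l ih =>
    intro a b h
    rw [isReduced_cons_cons] at h
    obtain ⟨h1, h2⟩ := ih b c h.2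
    have hbc := (isReduced_cons_cons.1 h.2).1
    have hm := hf.middle a b c h.1 hbc
    rw [List.map_cons, List.prod_cons] at h2 ⊢
    rw [List.map_cons (f := letter f) (a := a), List.prod_cons]
    rw [List.map_cons (f := letter f) (a := b), List.prod_cons]
    set Q := ((c :: l).map (letter f)).prod
    set x := letter f a
    set y := letter f b
    have e1 := norm_mul_add y Q
    have e2 := norm_inv_mul_add y (y * Q)
    rw [inv_mul_cancel_left] at e2
    have t1 := min_gromovProduct_le x⁻¹ y (y * Q)
    have t2 := min_gromovProduct_le x⁻¹ (y * Q) y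
    rw [gromovProduct_comm (y * Q) y] at t2
    have e3 := norm_mul_add x (y * Q)
    have key : gromovProduct x⁻¹ (y * Q) = gromovProduct x⁻¹ y := by omega
    exact ⟨key, by omega⟩

theorem IsNielsenReduced.exists_letter_eq {f : β → FreeGroup α} (hf : IsNielsenReduced f)
    {g : FreeGroup α} (hg : norm g = 1) (hmem : g ∈ Subgroup.closure (Set.range f)) :
    ∃ a, g = letter f a := by
  classical
  rw [← range_lift_eq_closure] at hmem
  obtain ⟨w, rfl⟩ := hmem
  have hw : lift f w = (w.toWord.map (letter f)).prod := by
    nth_rewrite 1 [← mk_toWord (x := w)]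
    rw [lift_mk]
    rfl
  have hr := isReduced_toWord (x := w)
  rw [hw] at hg ⊢
  generalize w.toWord = l at hg hr
  match l with
  | [] => simp at hg
  | [a] => exact ⟨a, by simp⟩
  | a :: b :: l =>
    have h1 := (hf.gromovProduct_prod l a b hr).2
    have h2 := hf.left a b (isReduced_cons_cons.1 hr).1
    have h3 : norm (letter f a) ≠ 0 := by simpa using hf.ne_one a
    omega

theorem letter_not {G : Type*} [Group G] (f : β → G) (i : β) (s : Bool) :
    letter f (i, !s) = (letter f (i, s))⁻¹ := by
  cases s <;> simp [letter]

theorem isNielsenReduced_of_forall_ne {f : Bool → FreeGroup α} (h1 : ∀ a, letter f a ≠ 1)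
    (hl : ∀ a b : Bool × Bool, a.1 ≠ b.1 →
      norm (letter f a) ≤ norm (letter f a * letter f b))
    (hr : ∀ a b : Bool × Bool, a.1 ≠ b.1 →
      norm (letter f b) ≤ norm (letter f a * letter f b))
    (hm : ∀ a b : Bool × Bool, a.1 ≠ b.1 →
      2 * gromovProduct (letter f a)⁻¹ (letter f b) = norm (letter f b) →
      2 * gromovProduct (letter f b)⁻¹ (letter f a) ≠ norm (letter f b)) :
    IsNielsenReduced f := by
  have left : ∀ a b : Bool × Bool, (a.1 = b.1 → a.2 = b.2) →
      2 * gromovProduct (letter f a)⁻¹ (letter f b) ≤ norm (letter f a) := by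
    intro a b hab
    by_cases h : a.1 = b.1
    · obtain rfl : a = b := Prod.ext h (hab h)
      exact (two_mul_gromovProduct_inv_self_lt (h1 a)).le
    · have := hr a b h
      have := norm_mul_add (letter f a) (letter f b)
      omega
  have right : ∀ a b : Bool × Bool, (a.1 = b.1 → a.2 = b.2) →
      2 * gromovProduct (letter f a)⁻¹ (letter f b) ≤ norm (letter f b) := by
    intro a b hab
    by_cases h : a.1 = b.1
    · obtain rfl : a = b := Prod.ext h (hab h)
      exact (two_mul_gromovProduct_inv_self_lt (h1 a)).le
    · have := hl a b h
      have := norm_mul_add (letter f a) (letter f b)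
      omega
  refine ⟨h1, left, right, fun a b c hab hbc => ?_⟩
  have hab' := right a b hab
  have hbc' := left b c hbc
  have hb := two_mul_gromovProduct_inv_self_lt (h1 b)
  by_cases h : a.1 = b.1
  · obtain rfl : a = b := Prod.ext h (hab h)
    omega
  by_cases h' : b.1 = c.1
  · obtain rfl : b = c := Prod.ext h' (hbc h')
    omega
  have hac : c.1 = a.1 := by
    revert h h'; cases a.1 <;> cases b.1 <;> cases c.1 <;> simp
  by_cases hs : c.2 = a.2
  · obtain rfl : c = a := Prod.ext hac hs
    have := hm c b h
    omega
  · have hca : letter f c = (letter f a)⁻¹ := by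
      rw [← letter_not]
      congr 1
      refine Prod.ext hac ?_
      revert hs; cases c.2 <;> cases a.2 <;> simp
    rw [hca] at hbc' ⊢
    have := min_gromovProduct_le (letter f b)⁻¹ (letter f a)⁻¹ (letter f b)
    omega

end FreeGroup

open FreeGroup

theorem closure_pair_eq_top_of_mem {x y x' y' : F2}
    (h : Subgroup.closure ({x, y} : Set F2) = ⊤)
    (hx : x ∈ Subgroup.closure ({x', y'} : Set F2))
    (hy : y ∈ Subgroup.closure ({x', y'} : Set F2)) :
    Subgroup.closure ({x', y'} : Set F2) = ⊤ := by
  rw [eq_top_iff, ← h, Subgroup.closure_le]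
  rintro z (rfl | rfl)
  exacts [hx, hy]

theorem closure_pair_conj_eq_top {x y : F2} (g : F2)
    (h : Subgroup.closure ({x, y} : Set F2) = ⊤) :
    Subgroup.closure ({g * x * g⁻¹, g * y * g⁻¹} : Set F2) = ⊤ := by
  have := congrArg (Subgroup.map (MulAut.conj g).toMonoidHom) h
  rw [MonoidHom.map_closure, Set.image_pair,
    Subgroup.map_top_of_surjective _ (MulAut.conj g).surjective] at this
  exact this

theorem closure_singleton_ne_top (x : F2) : Subgroup.closure ({x} : Set F2) ≠ ⊤ := by
  intro h
  rw [← Subgroup.zpowers_eq_closure] at h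
  obtain ⟨m, hm⟩ := Subgroup.mem_zpowers_iff.1 (h ▸ Subgroup.mem_top A)
  obtain ⟨n, hn⟩ := Subgroup.mem_zpowers_iff.1 (h ▸ Subgroup.mem_top B)
  have : A * B = B * A := by rw [← hm, ← hn, zpow_mul_comm]
  revert this
  decide

/-- A property of pairs of elements which is stable under swapping, inversion, Nielsen
transvections, and simultaneous conjugation. -/
structure IsNielsenInvariant (P : F2 → F2 → Prop) : Prop where
  swap : ∀ {x y}, P x y → P y x
  inv : ∀ {x y}, P x y → P x⁻¹ y
  conj : ∀ {x y} (g), P x y → P (g * x * g⁻¹) (g * y * g⁻¹)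
  mul : ∀ {x y}, P x y → P x (x * y)

namespace IsNielsenInvariant

variable {P : F2 → F2 → Prop}

theorem of_inv (hP : IsNielsenInvariant P) {x y : F2} (h : P x⁻¹ y) : P x y := by
  simpa using hP.inv h

theorem of_mul_right (hP : IsNielsenInvariant P) {x y : F2} (h : P x (x * y)) : P x y := by
  have := hP.mul (hP.inv h)
  rw [inv_mul_cancel_left] at this
  exact hP.of_inv this

theorem of_mul_left (hP : IsNielsenInvariant P) {x y : F2} (h : P (x * y) y) : P x y := by
  have h1 := hP.inv (hP.swap (hP.inv h))
  have h2 := hP.of_mul_right (x := y⁻¹) (y := x⁻¹) (by simpa using h1)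
  exact hP.of_inv (hP.swap (hP.of_inv h2))

theorem of_conj (hP : IsNielsenInvariant P) {x y : F2} (g : F2)
    (h : P (g * x * g⁻¹) (g * y * g⁻¹)) : P x y := by
  have := hP.conj g⁻¹ h
  simpa [mul_assoc] using this

theorem of_letter (hP : IsNielsenInvariant P) {f : Bool → F2} {a b : Bool × Bool}
    (hab : a.1 ≠ b.1) (h : P (letter f a) (letter f b)) : P (f true) (f false) := by
  obtain ⟨i, s⟩ := a
  obtain ⟨j, t⟩ := b
  have key : ∀ i j, P (letter f (i, s)) (letter f (j, t)) → P (f i) (f j) := by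
    intro i j h
    have h1 : P (f i) (letter f (j, t)) := by
      cases s
      exacts [hP.of_inv h, h]
    cases t
    exacts [hP.swap (hP.of_inv (hP.swap h1)), h1]
  have h1 := key i j h
  cases i <;> cases j <;> simp at hab
  exacts [hP.swap h1, h1]

end IsNielsenInvariant

theorem closure_letter_eq_top {f : Bool → F2} (hf : Subgroup.closure {f true, f false} = ⊤)
    {a b : Bool × Bool} (hab : a.1 ≠ b.1) :
    Subgroup.closure {letter f a, letter f b} = ⊤ := by
  have key : ∀ a b : Bool × Bool, f a.1 ∈ Subgroup.closure {letter f a, letter f b} := by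
    rintro ⟨i, s⟩ b
    have : letter f (i, s) ∈ Subgroup.closure {letter f (i, s), letter f b} :=
      Subgroup.subset_closure (by simp)
    cases s
    exacts [inv_mem_iff.1 this, this]
  have ha := key a b
  have hb := key b a
  rw [Set.pair_comm] at hb
  refine closure_pair_eq_top_of_mem hf ?_ ?_ <;>
    revert ha hb hab <;> cases a.1 <;> cases b.1 <;> simp +contextual

/-- Nielsen's theorem: every generating pair of `F2` is obtained from `(A, B)` by swaps, inversions,
transvections and conjugations. -/
theorem IsNielsenInvariant.of_closure_eq_top {P : F2 → F2 → Prop} (hP : IsNielsenInvariant P)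
    (hAB : P A B) {x y : F2} (h : Subgroup.closure {x, y} = ⊤) : P x y := by
  induction hn : norm x + norm y using Nat.strong_induction_on generalizing x y with
  | _ n ih =>
  by_contra hxy
  have hmin : ∀ {x' y'}, Subgroup.closure {x', y'} = ⊤ → (P x' y' → P x y) →
      norm x + norm y ≤ norm x' + norm y' := by
    intro x' y' h1 h2
    by_contra! hlt
    exact hxy (h2 (ih _ (hn ▸ hlt) h1 rfl))
  obtain ⟨f, rfl, rfl⟩ : ∃ f : Bool → F2, f true = x ∧ f false = y := ⟨fun b => cond b x y, rfl, rfl⟩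
  have hsum : ∀ a b : Bool × Bool, a.1 ≠ b.1 →
      norm (f true) + norm (f false) = norm (letter f a) + norm (letter f b) := by
    rintro ⟨i, s⟩ ⟨j, t⟩
    cases i <;> cases s <;> cases j <;> cases t <;> simp [letter, add_comm]
  have hr : ∀ a b : Bool × Bool, a.1 ≠ b.1 →
      norm (letter f b) ≤ norm (letter f a * letter f b) := by
    intro a b hab
    have h1 := hsum a b hab
    have h2 := hmin (x' := letter f a) (y' := letter f a * letter f b)
      (closure_pair_eq_top_of_mem (closure_letter_eq_top h hab) (Subgroup.subset_closure (by simp))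
        ((Subgroup.mul_mem_cancel_left _ (Subgroup.subset_closure (by simp))).1
          (Subgroup.subset_closure (Set.mem_insert_of_mem _ rfl))))
      (fun h => hP.of_letter hab (hP.of_mul_right h))
    omega
  have hl : ∀ a b : Bool × Bool, a.1 ≠ b.1 →
      norm (letter f a) ≤ norm (letter f a * letter f b) := by
    intro a b hab
    have := hr (b.1, !b.2) (a.1, !a.2) hab.symm
    rwa [letter_not, letter_not, ← mul_inv_rev, norm_inv_eq, norm_inv_eq] at this
  have h1 : ∀ a, letter f a ≠ 1 := by
    intro a ha
    have := closure_letter_eq_top h (a := a) (b := (!a.1, true)) (by simp)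
    rw [ha, Subgroup.closure_insert_one] at this
    exact closure_singleton_ne_top _ this
  have hm : ∀ a b : Bool × Bool, a.1 ≠ b.1 →
      2 * gromovProduct (letter f a)⁻¹ (letter f b) = norm (letter f b) →
      2 * gromovProduct (letter f b)⁻¹ (letter f a) ≠ norm (letter f b) := by
    intro a b hab e1 e2
    have hs := hsum a b hab
    have hrv := hr a b hab
    have hgen := closure_letter_eq_top h hab
    have hPab := hP.of_letter (f := f) hab
    have hb : norm (letter f b) ≠ 0 := by simpa using h1 b
    generalize letter f a = u at *
    generalize letter f b = v at *
    have huv := norm_mul_add u v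
    obtain ⟨p, hp1, hp2⟩ := exists_norm_eq_of_le v (k := gromovProduct u⁻¹ v) (by omega)
    have hpv := norm_inv_mul_add p v
    have hup := min_gromovProduct_le u⁻¹ v p
    rw [gromovProduct_comm v p] at hup
    obtain ⟨q, hq⟩ : ∃ q, q = v⁻¹ * p := ⟨_, rfl⟩
    have hq1 : norm q = norm v - gromovProduct u⁻¹ v := by
      rw [← hp2, ← norm_inv_eq, hq, mul_inv_rev, inv_inv]
    have hqv := norm_inv_mul_add q v⁻¹
    rw [show q⁻¹ * v⁻¹ = p⁻¹ by rw [hq]; group, norm_inv_eq, norm_inv_eq] at hqv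
    have hqu := min_gromovProduct_le q v⁻¹ u
    have hqu' := gromovProduct_le_left q u
    have hqu2 := norm_inv_mul_add q u
    have h3 := norm_inv_mul_add (u⁻¹ * q) u⁻¹
    rw [show (u⁻¹ * q)⁻¹ * u⁻¹ = q⁻¹ by group, norm_inv_eq, norm_inv_eq,
      show norm (u⁻¹ * q) = norm (q⁻¹ * u) by rw [← norm_inv_eq]; congr 1; group] at h3
    have h4 := min_gromovProduct_le (u⁻¹ * q) u⁻¹ p
    have h5 := norm_inv_mul_add (u⁻¹ * q) p
    rw [show (u⁻¹ * q)⁻¹ * p = q⁻¹ * (u * v) * q⁻¹⁻¹ by rw [hq]; group,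
      show norm (u⁻¹ * q) = norm (q⁻¹ * u) by rw [← norm_inv_eq]; congr 1; group] at h5
    have h6 : norm (q⁻¹ * v * q⁻¹⁻¹) ≤ norm v := by
      rw [show q⁻¹ * v * q⁻¹⁻¹ = q⁻¹ * p by rw [hq]; group]
      have := norm_mul_le q⁻¹ p
      rw [norm_inv_eq] at this
      omega
    have h7 := hmin (closure_pair_conj_eq_top q⁻¹ (x := u * v) (y := v)
      (closure_pair_eq_top_of_mem hgen
        ((Subgroup.mul_mem_cancel_right _ (Subgroup.subset_closure (by simp))).1
          (Subgroup.subset_closure (Set.mem_insert _ _)))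
        (Subgroup.subset_closure (by simp))))
      (fun h => hPab (hP.of_mul_left (hP.of_conj _ h)))
    omega
  have hf := isNielsenReduced_of_forall_ne h1 hl hr hm
  have hrange : Subgroup.closure (Set.range f) = ⊤ := by
    rw [← h]
    congr 1
    ext z
    simp [or_comm]
  obtain ⟨a, ha⟩ := hf.exists_letter_eq (g := A) (norm_of _) (hrange ▸ Subgroup.mem_top _)
  obtain ⟨b, hb⟩ := hf.exists_letter_eq (g := B) (norm_of _) (hrange ▸ Subgroup.mem_top _)
  have hab : a.1 ≠ b.1 := by
    intro hab
    have : A = B ∨ A = B⁻¹ := by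
      rw [ha, hb]
      obtain ⟨i, s⟩ := a
      obtain ⟨j, t⟩ := b
      obtain rfl : i = j := hab
      cases s <;> cases t <;> simp [letter]
    revert this
    decide
  exact hxy (hP.of_letter hab (ha ▸ hb ▸ hAB))

/-- The pairs obtained from `(A, e)` by positive transvections. -/
inductive IsPositivePair (e : F2) : F2 → F2 → Prop
  | base : IsPositivePair e A e
  | left {x y} : IsPositivePair e x y → IsPositivePair e (x * y) y
  | right {x y} : IsPositivePair e x y → IsPositivePair e x (x * y)

/-- Up to inversion of the entries and simultaneous conjugation, the pair is a positive pair in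
`A` and `B` or in `A` and `B⁻¹`. -/
def IsSignedPositivePair (x y : F2) : Prop :=
  ∃ e p q g, (e = B ∨ e = B⁻¹) ∧ IsPositivePair e p q ∧
    (x = g * p * g⁻¹ ∨ x = g * p⁻¹ * g⁻¹) ∧ (y = g * q * g⁻¹ ∨ y = g * q⁻¹ * g⁻¹)

namespace IsSignedPositivePair

variable {x y : F2}

theorem inv_left (h : IsSignedPositivePair x y) : IsSignedPositivePair x⁻¹ y := by
  obtain ⟨e, p, q, g, he, hpq, hx, hy⟩ := h
  refine ⟨e, p, q, g, he, hpq, ?_, hy⟩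
  rcases hx with rfl | rfl
  · exact .inr (by group)
  · exact .inl (by group)

theorem inv_right (h : IsSignedPositivePair x y) : IsSignedPositivePair x y⁻¹ := by
  obtain ⟨e, p, q, g, he, hpq, hx, hy⟩ := h
  refine ⟨e, p, q, g, he, hpq, hx, ?_⟩
  rcases hy with rfl | rfl
  · exact .inr (by group)
  · exact .inl (by group)

theorem conj (h : IsSignedPositivePair x y) (k : F2) :
    IsSignedPositivePair (k * x * k⁻¹) (k * y * k⁻¹) := by
  obtain ⟨e, p, q, g, he, hpq, hx, hy⟩ := h
  refine ⟨e, p, q, k * g, he, hpq, ?_, ?_⟩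
  · rcases hx with rfl | rfl
    · exact .inl (by group)
    · exact .inr (by group)
  · rcases hy with rfl | rfl
    · exact .inl (by group)
    · exact .inr (by group)

theorem of_isPositivePair {e p q : F2} (he : e = B ∨ e = B⁻¹) (h : IsPositivePair e p q) :
    IsSignedPositivePair p q :=
  ⟨e, p, q, 1, he, h, .inl (by simp), .inl (by simp)⟩

theorem mul_inv_right {e p q : F2} (he : e = B ∨ e = B⁻¹) (h : IsPositivePair e p q) :
    IsSignedPositivePair p (p * q⁻¹) ∨ IsSignedPositivePair (p * q⁻¹) p := by
  cases h with
  | base =>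
    have he' : e⁻¹ = B ∨ e⁻¹ = B⁻¹ := by rcases he with rfl | rfl <;> simp
    exact .inl (of_isPositivePair he' (.right .base))
  | @left x _ h =>
    right
    simpa using of_isPositivePair he (.right h)
  | @right _ y h =>
    left
    have := ((of_isPositivePair he h).inv_right).conj p
    simpa [mul_assoc] using this

theorem mul_inv_left {e p q : F2} (he : e = B ∨ e = B⁻¹) (h : IsPositivePair e p q) :
    IsSignedPositivePair (p * q⁻¹) q ∨ IsSignedPositivePair q (p * q⁻¹) := by
  cases h with
  | base =>
    have he' : e⁻¹ = B ∨ e⁻¹ = B⁻¹ := by rcases he with rfl | rfl <;> simp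
    left
    simpa using (of_isPositivePair he' (.left .base)).inv_right
  | left h =>
    left
    simpa using of_isPositivePair he h
  | @right _ y h =>
    right
    have := ((of_isPositivePair he (.left h)).inv_right).conj (p * y)
    simpa [mul_assoc] using this

end IsSignedPositivePair

theorem isNielsenInvariant_isSignedPositivePair :
    IsNielsenInvariant fun x y => IsSignedPositivePair x y ∨ IsSignedPositivePair y x := by
  have swap : ∀ {x y}, IsSignedPositivePair x y ∨ IsSignedPositivePair y x →
      IsSignedPositivePair y x ∨ IsSignedPositivePair x y := Or.symm
  have inv : ∀ {x y}, IsSignedPositivePair x y ∨ IsSignedPositivePair y x →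
      IsSignedPositivePair x⁻¹ y ∨ IsSignedPositivePair y x⁻¹ :=
    Or.imp .inv_left .inv_right
  have conj : ∀ {x y} (g), IsSignedPositivePair x y ∨ IsSignedPositivePair y x →
      IsSignedPositivePair (g * x * g⁻¹) (g * y * g⁻¹) ∨
        IsSignedPositivePair (g * y * g⁻¹) (g * x * g⁻¹) :=
    fun g => Or.imp (.conj · g) (.conj · g)
  refine ⟨swap, inv, conj, ?_⟩
  have mul_conj : ∀ {x y} (g), IsSignedPositivePair x (x * y) ∨ IsSignedPositivePair (x * y) x →
      IsSignedPositivePair (g * x * g⁻¹) (g * x * g⁻¹ * (g * y * g⁻¹)) ∨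
        IsSignedPositivePair (g * x * g⁻¹ * (g * y * g⁻¹)) (g * x * g⁻¹) := by
    intro x y g h
    simpa [mul_assoc] using conj g h
  have mul_inv : ∀ {x y}, IsSignedPositivePair x (x * y) ∨ IsSignedPositivePair (x * y) x →
      IsSignedPositivePair x⁻¹ (x⁻¹ * y⁻¹) ∨ IsSignedPositivePair (x⁻¹ * y⁻¹) x⁻¹ := by
    intro x y h
    simpa [mul_assoc] using conj x⁻¹ (inv (swap (inv (swap h))))
  have mul_comm' : ∀ {x y}, IsSignedPositivePair x (y * x) ∨ IsSignedPositivePair (y * x) x →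
      IsSignedPositivePair x (x * y) ∨ IsSignedPositivePair (x * y) x := by
    intro x y h
    simpa [mul_assoc] using conj x h
  rintro x y (⟨e, p, q, g, he, hpq, hx, hy⟩ | ⟨e, p, q, g, he, hpq, hx, hy⟩)
  · have h1 : IsSignedPositivePair p (p * q) ∨ IsSignedPositivePair (p * q) p :=
      .inl (.of_isPositivePair he (.right hpq))
    have h2 := IsSignedPositivePair.mul_inv_right he hpq
    rcases hx with rfl | rfl <;> rcases hy with rfl | rfl <;> apply mul_conj
    exacts [h1, h2, by simpa using mul_inv h2, mul_inv h1]
  · have h1 : IsSignedPositivePair q (q * p) ∨ IsSignedPositivePair (q * p) q :=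
      mul_comm' (.inr (.of_isPositivePair he (.left hpq)))
    have h2 : IsSignedPositivePair q (q * p⁻¹) ∨ IsSignedPositivePair (q * p⁻¹) q := by
      simpa using swap (inv (IsSignedPositivePair.mul_inv_left he hpq))
    rcases hx with rfl | rfl <;> rcases hy with rfl | rfl <;> apply mul_conj
    exacts [h1, by simpa using mul_inv h2, h2, mul_inv h1]

/-- The exponent sum of the generator `i`. -/
def exponentSum (i : Bool) : F2 →* Multiplicative ℤ :=
  FreeGroup.lift fun j => Multiplicative.ofAdd (if j = i then 1 else 0)

/-- Elements with nonnegative `A`-exponent sum, which are powers of `B` when that sum is zero. -/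
def NonnegOrPower (m : F2) : Prop :=
  0 ≤ (exponentSum true m).toAdd ∧
    ((exponentSum true m).toAdd = 0 → m ∈ Subgroup.zpowers B)

theorem NonnegOrPower.mul {m n : F2} (hm : NonnegOrPower m) (hn : NonnegOrPower n) :
    NonnegOrPower (m * n) := by
  obtain ⟨h1, h2⟩ := hm
  obtain ⟨h3, h4⟩ := hn
  have h : (exponentSum true (m * n)).toAdd =
      (exponentSum true m).toAdd + (exponentSum true n).toAdd := by
    rw [_root_.map_mul, toAdd_mul]
  rw [NonnegOrPower, h]
  exact ⟨by omega, fun h => mul_mem (h2 (by omega)) (h4 (by omega))⟩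

theorem IsPositivePair.nonnegOrPower {e p q : F2} (he : e = B ∨ e = B⁻¹)
    (h : IsPositivePair e p q) : NonnegOrPower p ∧ NonnegOrPower q := by
  induction h with
  | base =>
    refine ⟨by simp [NonnegOrPower, exponentSum, A], ?_⟩
    rcases he with rfl | rfl
    · exact ⟨by simp [exponentSum, B], fun _ => Subgroup.mem_zpowers B⟩
    · exact ⟨by simp [exponentSum, B], fun _ => inv_mem (Subgroup.mem_zpowers B)⟩
  | left _ ih => exact ⟨ih.1.mul ih.2, ih.2⟩
  | right _ ih => exact ⟨ih.1, ih.1.mul ih.2⟩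

theorem IsSignedPositivePair.exists_isConj_zpow {x y w : F2} (h : IsSignedPositivePair x y)
    (hw : w = x ∨ w = y) (hw0 : exponentSum true w = 1) : ∃ k : ℤ, IsConj w (B ^ k) := by
  obtain ⟨e, p, q, g, he, hpq, hx, hy⟩ := h
  have key : ∀ {m : F2}, NonnegOrPower m → (w = g * m * g⁻¹ ∨ w = g * m⁻¹ * g⁻¹) →
      ∃ k : ℤ, IsConj w (B ^ k) := by
    intro m hm hwm
    have h0 : exponentSum true m = 1 := by
      rcases hwm with rfl | rfl <;> simpa using hw0
    obtain ⟨k, rfl⟩ := Subgroup.mem_zpowers_iff.1 (hm.2 (by rw [h0]; rfl))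
    rcases hwm with rfl | rfl
    · exact ⟨k, (isConj_iff.2 ⟨g, rfl⟩).symm⟩
    · exact ⟨-k, (isConj_iff.2 ⟨g, by rw [zpow_neg]⟩).symm⟩
  have hpos := hpq.nonnegOrPower he
  rcases hw with rfl | rfl
  exacts [key hpos.1 hx, key hpos.2 hy]

theorem IsPrimitive.exists_mulEquiv {w : F2} (hw : IsPrimitive w) : ∃ φ : F2 ≃* F2, φ B = w := by
  obtain ⟨x, y, ⟨φ, hx, hy⟩, rfl | rfl⟩ := hw
  · exact ⟨(freeGroupCongr Equiv.boolNot).trans φ, by simpa [B, A] using hx⟩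
  · exact ⟨φ, hy⟩

theorem IsBasis.closure_eq_top {x y : F2} (h : IsBasis x y) : Subgroup.closure {x, y} = ⊤ := by
  obtain ⟨φ, rfl, rfl⟩ := h
  have : Set.range (FreeGroup.of : Bool → F2) = {A, B} := by
    ext z
    simp [A, B, or_comm]
  rw [← Set.image_pair, ← this, ← MulEquiv.coe_toMonoidHom, ← MonoidHom.map_closure,
    closure_range_of, Subgroup.map_top_of_surjective _ φ.surjective]

theorem IsPrimitive.eq_one_or_eq_neg_one_of_isConj_zpow {w : F2} (hw : IsPrimitive w) {k : ℤ}
    (h : IsConj w (B ^ k)) : k = 1 ∨ k = -1 := by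
  obtain ⟨φ, rfl⟩ := hw.exists_mulEquiv
  have h1 := (exponentSum false).map_isConj (φ.symm.toMonoidHom.map_isConj h)
  rw [isConj_iff_eq] at h1
  have h2 : exponentSum false B = Multiplicative.ofAdd 1 := by simp [exponentSum, B]
  simp [h2] at h1
  have h3 := congrArg Multiplicative.toAdd h1
  simp at h3
  exact Int.isUnit_iff.1 (IsUnit.of_mul_eq_one _ h3.symm)

theorem stmt_16 (w : F2) (hw : IsPrimitive w)
    (hmem : w ∈ Subgroup.normalClosure ({B} : Set F2)) :
    IsConj w B ∨ IsConj w B⁻¹ := by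
  have hw0 : exponentSum true w = 1 := by
    have : Subgroup.normalClosure {B} ≤ (exponentSum true).ker :=
      Subgroup.normalClosure_le_normal (by simp [exponentSum, B])
    exact this hmem
  obtain ⟨k, hk⟩ : ∃ k : ℤ, IsConj w (B ^ k) := by
    obtain ⟨x, y, hxy, hwxy⟩ := hw
    rcases isNielsenInvariant_isSignedPositivePair.of_closure_eq_top
      (.inl (.of_isPositivePair (.inl rfl) .base)) hxy.closure_eq_top with h | h
    · exact h.exists_isConj_zpow hwxy hw0
    · exact h.exists_isConj_zpow hwxy.symm hw0
  rcases hw.eq_one_or_eq_neg_one_of_isConj_zpow hk with rfl | rfl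
  · exact .inl (by simpa using hk)
  · exact .inr (by simpa using hk)
end
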